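/- arXiv:2602.07844 — 6 statements merged into one kernel-verified Lean document; each statement's English description precedes it below -/
import Mathlib

section
/- Let m, n ≥ 2 and let E ⊆ [m] × [n] be the edge set of a bipartite graph G with parts [m] and [n]. If G contains no 4-cycle (i.e., there are no indices i ≠ k in [m] and j ≠ l in [n] with (i,j), (i,l), (k,j), (k,l) all in E), then the sos rank of the simple biquadratic form P_G(x,y) = Σ_{(i,j)∈E} x_i² y_j² equals |E|. -/
lemma bil_eval {m n : ℕ} (g : Fin m → Fin n → ℝ) (i k : Fin m) (j l : Fin n) (a b p q : ℝ) :
    ∑ i', ∑ j', g i' j' * (Pi.single i a + Pi.single k b : Fin m → ℝ) i' *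
      (Pi.single j p + Pi.single l q : Fin n → ℝ) j' =
    g i j * a * p + g i l * a * q + g k j * b * p + g k l * b * q := by
  simp [mul_add, add_mul, Finset.sum_add_distrib, Pi.single_apply]
  ring

lemma quad_eval {m n : ℕ} (E : Finset (Fin m × Fin n)) (i k : Fin m) (j l : Fin n)
    (hik : i ≠ k) (hjl : j ≠ l) (a b p q : ℝ) :
    ∑ e ∈ E, ((Pi.single i a + Pi.single k b : Fin m → ℝ) e.1) ^ 2 *
      ((Pi.single j p + Pi.single l q : Fin n → ℝ) e.2) ^ 2 =
    (if (i, j) ∈ E then 1 else 0) * a ^ 2 * p ^ 2 + (if (i, l) ∈ E then 1 else 0) * a ^ 2 * q ^ 2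
    + (if (k, j) ∈ E then 1 else 0) * b ^ 2 * p ^ 2
    + (if (k, l) ∈ E then 1 else 0) * b ^ 2 * q ^ 2 := by
  have hx : ∀ z, ((Pi.single i a + Pi.single k b : Fin m → ℝ) z) ^ 2
      = (Pi.single i (a ^ 2) + Pi.single k (b ^ 2) : Fin m → ℝ) z := by
    intro z
    by_cases h1 : z = i <;> by_cases h2 : z = k <;> simp_all [Pi.single_apply]
  have hy : ∀ z, ((Pi.single j p + Pi.single l q : Fin n → ℝ) z) ^ 2
      = (Pi.single j (p ^ 2) + Pi.single l (q ^ 2) : Fin n → ℝ) z := by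
    intro z
    by_cases h1 : z = j <;> by_cases h2 : z = l <;> simp_all [Pi.single_apply]
  rw [← bil_eval (fun i j => if (i, j) ∈ E then (1 : ℝ) else 0) i k j l,
    ← Fintype.sum_prod_type', ← Finset.sum_filter_add_sum_filter_not Finset.univ (· ∈ E)]
  rw [Finset.sum_eq_zero (s := Finset.univ.filter (fun e => ¬ e ∈ E)), add_zero]
  · rw [Finset.filter_mem_eq_inter, Finset.univ_inter]
    refine Finset.sum_congr rfl fun e he => ?_
    rw [hx, hy, if_pos he, one_mul]
  · intro e he
    rw [if_neg (Finset.mem_filter.1 he).2]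
    simp

/-- If the bipartite graph with edge set `E ⊆ [m]×[n]` contains no
4-cycle, then the sos rank of the simple biquadratic form
`P_G(x,y) = Σ_{(i,j)∈E} x_i² y_j²` equals `|E|`. -/
theorem sos_rank_of_C4_free_eq_card (m n : ℕ) (hm : 2 ≤ m) (hn : 2 ≤ n)
    (E : Finset (Fin m × Fin n))
    (hC4 : ¬ ∃ (i k : Fin m) (j l : Fin n), i ≠ k ∧ j ≠ l ∧
      (i, j) ∈ E ∧ (i, l) ∈ E ∧ (k, j) ∈ E ∧ (k, l) ∈ E) :
    IsLeast {r : ℕ | ∃ c : Fin r → Fin m → Fin n → ℝ,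
        ∀ (x : Fin m → ℝ) (y : Fin n → ℝ),
          (∑ e ∈ E, (x e.1) ^ 2 * (y e.2) ^ 2) =
            ∑ t, (∑ i, ∑ j, c t i j * x i * y j) ^ 2}
      E.card := by
  constructor
  · refine ⟨fun t i j => if ((E.equivFin.symm t : E) : Fin m × Fin n) = (i, j) then 1 else 0, ?_⟩
    intro x y
    have h : ∀ e : Fin m × Fin n,
        ∑ i, ∑ j, (if e = (i, j) then (1 : ℝ) else 0) * x i * y j = x e.1 * y e.2 := by
      intro e
      rw [← Fintype.sum_prod_type' (fun i j => (if e = (i, j) then (1 : ℝ) else 0) * x i * y j)]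
      simp [ite_mul]
    simp only [h]
    rw [Equiv.sum_comp E.equivFin.symm
      (fun e : E => (x (e : Fin m × Fin n).1 * y (e : Fin m × Fin n).2) ^ 2)]
    rw [← Finset.sum_coe_sort E]
    exact Finset.sum_congr rfl fun e _ => by ring
  · rintro r ⟨c, hc⟩
    have key : ∀ (i k : Fin m) (j l : Fin n), i ≠ k → j ≠ l → ∀ a b p q : ℝ,
        (if (i, j) ∈ E then 1 else 0) * a ^ 2 * p ^ 2
        + (if (i, l) ∈ E then 1 else 0) * a ^ 2 * q ^ 2
        + (if (k, j) ∈ E then 1 else 0) * b ^ 2 * p ^ 2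
        + (if (k, l) ∈ E then 1 else 0) * b ^ 2 * q ^ 2 =
        ∑ t, (c t i j * a * p + c t i l * a * q + c t k j * b * p + c t k l * b * q) ^ 2 := by
      intro i k j l hik hjl a b p q
      rw [← quad_eval E i k j l hik hjl, hc]
      exact Finset.sum_congr rfl fun t _ => by rw [bil_eval]
    have : Nontrivial (Fin m) := Fin.nontrivial_iff_two_le.2 hm
    have : Nontrivial (Fin n) := Fin.nontrivial_iff_two_le.2 hn
    have hnorm : ∀ i j, ∑ t, c t i j ^ 2 = if (i, j) ∈ E then 1 else 0 := by
      intro i j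
      obtain ⟨k, hk⟩ := exists_ne i
      obtain ⟨l, hl⟩ := exists_ne j
      have := key i k j l hk.symm hl.symm 1 0 1 0
      simpa using this.symm
    have hzero : ∀ i j, (i, j) ∉ E → ∀ t, c t i j = 0 := by
      intro i j h t
      have h1 := hnorm i j
      rw [if_neg h, Finset.sum_eq_zero_iff_of_nonneg (fun _ _ => sq_nonneg _)] at h1
      simpa using h1 t (Finset.mem_univ t)
    have hrow : ∀ i j l, j ≠ l → ∑ t, c t i j * c t i l = 0 := by
      intro i j l hjl
      obtain ⟨k, hk⟩ := exists_ne i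
      have h := key i k j l hk.symm hjl 1 0 1 1
      have e : ∑ t, (c t i j * 1 * 1 + c t i l * 1 * 1 + c t k j * 0 * 1 + c t k l * 0 * 1) ^ 2
          = ∑ t, c t i j ^ 2 + ∑ t, c t i l ^ 2 + 2 * ∑ t, c t i j * c t i l := by
        rw [Finset.mul_sum, ← Finset.sum_add_distrib, ← Finset.sum_add_distrib]
        exact Finset.sum_congr rfl fun t _ => by ring
      rw [e, hnorm, hnorm] at h
      linarith
    have hcol : ∀ i k j, i ≠ k → ∑ t, c t i j * c t k j = 0 := by
      intro i k j hik
      obtain ⟨l, hl⟩ := exists_ne j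
      have h := key i k j l hik hl.symm 1 1 1 0
      have e : ∑ t, (c t i j * 1 * 1 + c t i l * 1 * 0 + c t k j * 1 * 1 + c t k l * 1 * 0) ^ 2
          = ∑ t, c t i j ^ 2 + ∑ t, c t k j ^ 2 + 2 * ∑ t, c t i j * c t k j := by
        rw [Finset.mul_sum, ← Finset.sum_add_distrib, ← Finset.sum_add_distrib]
        exact Finset.sum_congr rfl fun t _ => by ring
      rw [e, hnorm, hnorm] at h
      linarith
    have hdiag : ∀ i k j l, i ≠ k → j ≠ l →
        ∑ t, c t i j * c t k l + ∑ t, c t i l * c t k j = 0 := by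
      intro i k j l hik hjl
      have h := key i k j l hik hjl 1 1 1 1
      have e : ∑ t, (c t i j * 1 * 1 + c t i l * 1 * 1 + c t k j * 1 * 1 + c t k l * 1 * 1) ^ 2
          = ∑ t, c t i j ^ 2 + ∑ t, c t i l ^ 2 + ∑ t, c t k j ^ 2 + ∑ t, c t k l ^ 2
            + 2 * ∑ t, c t i j * c t i l + 2 * ∑ t, c t k j * c t k l
            + 2 * ∑ t, c t i j * c t k j + 2 * ∑ t, c t i l * c t k l
            + 2 * ∑ t, c t i j * c t k l + 2 * ∑ t, c t i l * c t k j := by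
        simp only [Finset.mul_sum, ← Finset.sum_add_distrib]
        exact Finset.sum_congr rfl fun t _ => by ring
      rw [e, hnorm, hnorm, hnorm, hnorm, hrow i j l hjl, hrow k j l hjl, hcol i k j hik,
        hcol i k l hik] at h
      linarith
    let v : E → EuclideanSpace ℝ (Fin r) := fun e => WithLp.toLp 2 fun t => c t e.1.1 e.1.2
    have hv : Orthonormal ℝ v := by
      rw [orthonormal_iff_ite]
      rintro ⟨⟨i, j⟩, h1⟩ ⟨⟨k, l⟩, h2⟩
      have e : inner ℝ (v ⟨(i, j), h1⟩) (v ⟨(k, l), h2⟩) = ∑ t, c t i j * c t k l := by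
        simp [v, PiLp.inner_apply, mul_comm]
      rw [e]
      by_cases hik : i = k
      · subst hik
        by_cases hjl : j = l
        · subst hjl
          have := hnorm i j
          simp only [if_pos h1, sq] at this
          simpa using this
        · rw [hrow i j l hjl]; simp [hjl]
      · by_cases hjl : j = l
        · subst hjl
          rw [hcol i k j hik]; simp [hik]
        · have h0 : ∑ t, c t i l * c t k j = 0 := by
            refine Finset.sum_eq_zero fun t _ => ?_
            by_cases ha : (i, l) ∈ E
            · by_cases hb : (k, j) ∈ E
              · exact absurd ⟨i, k, j, l, hik, hjl, h1, ha, hb, h2⟩ hC4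
              · rw [hzero k j hb, mul_zero]
            · rw [hzero i l ha, zero_mul]
          have := hdiag i k j l hik hjl
          rw [h0, add_zero] at this
          rw [this]; simp [hik]
    simpa using hv.linearIndependent.fintype_card_le_finrank
end

section
/- Let m, n ≥ 2, let E ⊆ [m] × [n], and suppose P_G(x,y) = Σ_{t=1}^r L_t(x,y)² for all x ∈ ℝ^m, y ∈ ℝ^n, where L_t(x,y) = Σ_{i,j} c_{ij}^{(t)} x_i y_j are bilinear forms. For each pair (i,j) ∈ [m]×[n] define the vector v_{ij} = (c_{ij}^{(1)}, …, c_{ij}^{(r)}) ∈ ℝ^r. Then: (a) ‖v_{ij}‖² = 1 for every (i,j) ∈ E; (b) v_{ij} = 0 for every (i,j) ∉ E; and (c) v_{ij}·v_{kl} + v_{il}·v_{kj} = 0 for all i,k ∈ [m] and j,l ∈ [n] with ¬(i = k and j = l). -/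
theorem bilin_eval {m n : ℕ} (d : Fin m → Fin n → ℝ) (i k : Fin m) (j l : Fin n) (s u : ℝ) :
    ∑ a, ∑ b, d a b * ((if a = i then 1 else 0) + s * (if a = k then 1 else 0)) *
      ((if b = j then 1 else 0) + u * (if b = l then 1 else 0)) =
    d i j + u * d i l + s * d k j + s * u * d k l := by
  have h1 : ∀ a, ∑ b, d a b * ((if a = i then 1 else 0) + s * (if a = k then 1 else 0)) *
      ((if b = j then 1 else 0) + u * (if b = l then 1 else 0)) =
      (d a j + u * d a l) * (if a = i then 1 else 0) +
      (d a j + u * d a l) * s * (if a = k then 1 else 0) := by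
    intro a
    simp only [mul_add, Finset.sum_add_distrib, mul_ite, mul_one, mul_zero, Finset.sum_ite_eq',
      Finset.mem_univ, if_true]
    split_ifs <;> ring
  rw [Finset.sum_congr rfl fun a _ => h1 a]
  simp only [Finset.sum_add_distrib, mul_ite, mul_one, mul_zero, Finset.sum_ite_eq',
      Finset.mem_univ, if_true]
  ring

theorem ind_sq {m : ℕ} {i k : Fin m} (h : i ≠ k) (a : Fin m) :
    ((if a = i then (1:ℝ) else 0) + (-1) * (if a = k then 1 else 0)) ^ 2 =
    ((if a = i then (1:ℝ) else 0) + 1 * (if a = k then 1 else 0)) ^ 2 := by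
  by_cases h1 : a = i
  · have : a ≠ k := fun h2 => h (h1 ▸ h2)
    simp [this]
  · simp [h1]

/-- Suppose `P_G(x,y) = Σ_{t=1}^r L_t(x,y)²` with bilinear forms
`L_t(x,y) = Σ_{i,j} c_t i j x_i y_j`, and put `v_{ij} = (c_1 i j, …, c_r i j) ∈ ℝ^r`.
Then (a) `‖v_{ij}‖² = 1` for `(i,j) ∈ E`; (b) `v_{ij} = 0` for `(i,j) ∉ E`;
(c) `v_{ij}·v_{kl} + v_{il}·v_{kj} = 0` whenever `¬(i = k ∧ j = l)`. -/
theorem coefficient_vectors_of_sos_decomposition (m n : ℕ) (hm : 2 ≤ m) (hn : 2 ≤ n)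
    (E : Finset (Fin m × Fin n))
    (r : ℕ) (c : Fin r → Fin m → Fin n → ℝ)
    (hdecomp : ∀ (x : Fin m → ℝ) (y : Fin n → ℝ),
      (∑ e ∈ E, (x e.1) ^ 2 * (y e.2) ^ 2) =
        ∑ t, (∑ i, ∑ j, c t i j * x i * y j) ^ 2)
    (v : Fin m → Fin n → Fin r → ℝ)
    (hv : ∀ i j t, v i j t = c t i j) :
    (∀ i j, (i, j) ∈ E → (∑ t, (v i j t) ^ 2) = 1) ∧
    (∀ i j, (i, j) ∉ E → v i j = 0) ∧
    (∀ (i k : Fin m) (j l : Fin n), ¬(i = k ∧ j = l) →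
      (∑ t, v i j t * v k l t) + (∑ t, v i l t * v k j t) = 0) := by
  have key : ∀ (i k : Fin m) (j l : Fin n) (s u : ℝ),
      ∑ e ∈ E, ((if e.1 = i then (1:ℝ) else 0) + s * (if e.1 = k then 1 else 0)) ^ 2 *
        ((if e.2 = j then (1:ℝ) else 0) + u * (if e.2 = l then 1 else 0)) ^ 2 =
      ∑ t, (v i j t + u * v i l t + s * v k j t + s * u * v k l t) ^ 2 := by
    intro i k j l s u
    rw [hdecomp (fun a => (if a = i then (1:ℝ) else 0) + s * (if a = k then 1 else 0))
      (fun b => (if b = j then (1:ℝ) else 0) + u * (if b = l then 1 else 0))]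
    refine Finset.sum_congr rfl fun t _ => ?_
    rw [bilin_eval (c t)]
    simp only [hv]
  have diag : ∀ i j, ∑ t, (v i j t) ^ 2 = if (i, j) ∈ E then 1 else 0 := by
    intro i j
    have h := key i i j j 0 0
    simp only [zero_mul, add_zero] at h
    rw [← h, ← Finset.sum_ite_eq' E (i, j) (fun _ => (1:ℝ))]
    refine Finset.sum_congr rfl fun e _ => ?_
    rcases e with ⟨a, b⟩
    by_cases h1 : a = i <;> by_cases h2 : b = j <;> simp [h1, h2]
  refine ⟨fun i j h => by rw [diag, if_pos h], fun i j h => ?_, fun i k j l h => ?_⟩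
  · have h0 := diag i j
    rw [if_neg h, Finset.sum_eq_zero_iff_of_nonneg (fun _ _ => sq_nonneg _)] at h0
    funext t
    simpa using h0 t (Finset.mem_univ t)
  · have h8 : 8 * ((∑ t, v i j t * v k l t) + (∑ t, v i l t * v k j t)) =
        ∑ t, (v i j t + 1 * v i l t + 1 * v k j t + 1 * 1 * v k l t) ^ 2
        - ∑ t, (v i j t + 1 * v i l t + (-1) * v k j t + (-1) * 1 * v k l t) ^ 2
        - ∑ t, (v i j t + (-1) * v i l t + 1 * v k j t + 1 * (-1) * v k l t) ^ 2
        + ∑ t, (v i j t + (-1) * v i l t + (-1) * v k j t + (-1) * (-1) * v k l t) ^ 2 := by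
      rw [← Finset.sum_add_distrib, Finset.mul_sum, ← Finset.sum_sub_distrib,
        ← Finset.sum_sub_distrib, ← Finset.sum_add_distrib]
      refine Finset.sum_congr rfl fun t _ => ?_
      ring
    rw [← key, ← key, ← key, ← key] at h8
    by_cases hik : i = k
    · have hjl : j ≠ l := fun h' => h ⟨hik, h'⟩
      simp only [ind_sq hjl] at h8
      linarith
    · simp only [ind_sq hik] at h8
      linarith
end

section
/- Let m, n ≥ 2 and let E ⊆ [m] × [n] be C4-free. Suppose vectors v_{ij} ∈ ℝ^r are given for all (i,j) ∈ [m]×[n] such that v_{ij} = 0 whenever (i,j) ∉ E, and v_{ij}·v_{kl} + v_{il}·v_{kj} = 0 for all i,k ∈ [m], j,l ∈ [n] with ¬(i = k and j = l). Then for any two distinct edges (i,j), (k,l) ∈ E one has v_{ij}·v_{kl} = 0; that is, the vectors {v_{ij} : (i,j) ∈ E} are pairwise orthogonal. -/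
/-- If `E ⊆ [m]×[n]` is C4-free and the vectors `v_{ij} ∈ ℝ^r`
vanish off `E` and satisfy `v_{ij}·v_{kl} + v_{il}·v_{kj} = 0` whenever
`¬(i = k ∧ j = l)`, then the vectors indexed by distinct edges are pairwise
orthogonal. -/
theorem pairwise_orthogonal_of_C4_free (m n : ℕ) (hm : 2 ≤ m) (hn : 2 ≤ n)
    (E : Finset (Fin m × Fin n))
    (hC4 : ¬ ∃ (i k : Fin m) (j l : Fin n), i ≠ k ∧ j ≠ l ∧
      (i, j) ∈ E ∧ (i, l) ∈ E ∧ (k, j) ∈ E ∧ (k, l) ∈ E)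
    (r : ℕ) (v : Fin m → Fin n → Fin r → ℝ)
    (hzero : ∀ i j, (i, j) ∉ E → v i j = 0)
    (horth : ∀ (i k : Fin m) (j l : Fin n), ¬(i = k ∧ j = l) →
      (∑ t, v i j t * v k l t) + (∑ t, v i l t * v k j t) = 0) :
    ∀ (i k : Fin m) (j l : Fin n), (i, j) ∈ E → (k, l) ∈ E →
      (i, j) ≠ (k, l) → (∑ t, v i j t * v k l t) = 0 := by
  intro i k j l hij hkl hne
  have h := horth i k j l (fun hh => hne (by rw [hh.1, hh.2]))
  by_cases hik : i = k
  · subst hik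
    have e : (∑ t, v i l t * v i j t) = ∑ t, v i j t * v i l t :=
      Finset.sum_congr rfl (fun t _ => mul_comm _ _)
    linarith
  by_cases hjl : j = l
  · subst hjl
    linarith
  have h2 : (∑ t, v i l t * v k j t) = 0 := by
    by_cases hil : (i, l) ∈ E
    · have hkj : (k, j) ∉ E := fun hkj =>
        hC4 ⟨i, k, j, l, hik, hjl, hij, hil, hkj, hkl⟩
      simp [hzero k j hkj]
    · simp [hzero i l hil]
  linarith
end

section
/- The 3×3 simple biquadratic form P(x,y) = x₁²y₁² + x₂²y₂² + x₃²y₃² + x₁²y₂² + x₂²y₃² + x₃²y₁² has sos rank exactly 6: it is a sum of 6 squares of 3×3 bilinear forms, and it cannot be written as a sum of fewer than 6 squares of bilinear forms. -/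
/-- Expansion of a sum of squares of linear forms through the Gram matrix. -/
lemma sum_sq_gram {r : ℕ} (w : Fin 6 → Fin r → ℝ) (z : Fin 6 → ℝ) :
    ∑ p, (∑ s, w s p * z s) ^ 2 = ∑ s, ∑ t, (∑ p, w s p * w t p) * (z s * z t) := by
  simp_rw [sq, Finset.sum_mul_sum, Finset.sum_mul]
  rw [Finset.sum_comm]
  refine Finset.sum_congr rfl fun s _ => ?_
  rw [Finset.sum_comm]
  refine Finset.sum_congr rfl fun t _ => Finset.sum_congr rfl fun p _ => ?_
  ring

/-- The 3×3 simple biquadratic form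
`P(x,y) = x₁²y₁² + x₂²y₂² + x₃²y₃² + x₁²y₂² + x₂²y₃² + x₃²y₁²`
has sos rank exactly 6. -/
theorem sos_rank_three_by_three_example :
    IsLeast {r : ℕ | ∃ c : Fin r → Fin 3 → Fin 3 → ℝ,
        ∀ (x y : Fin 3 → ℝ),
          (x 0) ^ 2 * (y 0) ^ 2 + (x 1) ^ 2 * (y 1) ^ 2 + (x 2) ^ 2 * (y 2) ^ 2
            + (x 0) ^ 2 * (y 1) ^ 2 + (x 1) ^ 2 * (y 2) ^ 2 + (x 2) ^ 2 * (y 0) ^ 2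
          = ∑ p, (∑ i, ∑ j, c p i j * x i * y j) ^ 2}
      6 := by
  constructor
  · refine ⟨fun p i j => ![![![1,0,0],![0,0,0],![0,0,0]], ![![0,1,0],![0,0,0],![0,0,0]],
      ![![0,0,0],![0,1,0],![0,0,0]], ![![0,0,0],![0,0,1],![0,0,0]],
      ![![0,0,0],![0,0,0],![1,0,0]], ![![0,0,0],![0,0,0],![0,0,1]]] p i j, fun x y => ?_⟩
    simp [Fin.sum_univ_succ]
    ring
  · rintro r ⟨c, hc⟩
    have z02 : ∀ p, c p 0 2 = 0 := by
      have h := hc ![1,0,0] ![0,0,1]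
      simp [Fin.sum_univ_three] at h
      rw [eq_comm, Finset.sum_eq_zero_iff_of_nonneg (fun _ _ => sq_nonneg _)] at h
      simpa using h
    have z10 : ∀ p, c p 1 0 = 0 := by
      have h := hc ![0,1,0] ![1,0,0]
      simp [Fin.sum_univ_three] at h
      rw [eq_comm, Finset.sum_eq_zero_iff_of_nonneg (fun _ _ => sq_nonneg _)] at h
      simpa using h
    have z21 : ∀ p, c p 2 1 = 0 := by
      have h := hc ![0,0,1] ![0,1,0]
      simp [Fin.sum_univ_three] at h
      rw [eq_comm, Finset.sum_eq_zero_iff_of_nonneg (fun _ _ => sq_nonneg _)] at h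
      simpa using h
    set w : Fin 6 → Fin r → ℝ := ![fun p => c p 0 0, fun p => c p 0 1, fun p => c p 1 1,
      fun p => c p 1 2, fun p => c p 2 0, fun p => c p 2 2] with hw
    obtain ⟨G, hG⟩ : ∃ G : Fin 6 → Fin 6 → ℝ, ∀ s t, G s t = ∑ p, w s p * w t p :=
      ⟨_, fun _ _ => rfl⟩
    have hsymm : ∀ s t, G s t = G t s := fun s t => by
      rw [hG, hG]; exact Finset.sum_congr rfl fun p _ => mul_comm _ _
    have key : ∀ x0 x1 x2 y0 y1 y2 : ℝ,
        x0 ^ 2 * y0 ^ 2 + x1 ^ 2 * y1 ^ 2 + x2 ^ 2 * y2 ^ 2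
          + x0 ^ 2 * y1 ^ 2 + x1 ^ 2 * y2 ^ 2 + x2 ^ 2 * y0 ^ 2
        = ∑ s, ∑ t, G s t * (![x0 * y0, x0 * y1, x1 * y1, x1 * y2, x2 * y0, x2 * y2] s
            * ![x0 * y0, x0 * y1, x1 * y1, x1 * y2, x2 * y0, x2 * y2] t) := by
      intro x0 x1 x2 y0 y1 y2
      have h := hc ![x0, x1, x2] ![y0, y1, y2]
      simp_rw [hG]
      rw [← sum_sq_gram]
      refine Eq.trans (by simp) (h.trans (Finset.sum_congr rfl fun p _ => ?_))
      simp [Fin.sum_univ_three, Fin.sum_univ_six, hw, z02, z10, z21]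
      ring
    have hG1 : ∀ s t, G s t = if s = t then 1 else 0 := by
      simp only [Fin.sum_univ_six, Matrix.cons_val] at key
      have d0 := key 1 0 0 1 0 0
      have d1 := key 1 0 0 0 1 0
      have d2 := key 0 1 0 0 1 0
      have d3 := key 0 1 0 0 0 1
      have d4 := key 0 0 1 1 0 0
      have d5 := key 0 0 1 0 0 1
      have o01 := key 1 0 0 1 1 0
      have o02 := key 1 1 0 1 1 0
      have o03 := key 1 1 0 1 0 1
      have o04 := key 1 0 1 1 0 0
      have o05 := key 1 0 1 1 0 1
      have o12 := key 1 1 0 0 1 0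
      have o13 := key 1 1 0 0 1 1
      have o14 := key 1 0 1 1 1 0
      have o15 := key 1 0 1 0 1 1
      have o23 := key 0 1 0 0 1 1
      have o24 := key 0 1 1 1 1 0
      have o25 := key 0 1 1 0 1 1
      have o34 := key 0 1 1 1 0 1
      have o35 := key 0 1 1 0 0 1
      have o45 := key 0 0 1 1 0 1
      norm_num at d0 d1 d2 d3 d4 d5 o01 o02 o03 o04 o05 o12 o13 o14 o15 o23 o24 o25 o34 o35 o45
      have s01 := hsymm 0 1
      have s02 := hsymm 0 2
      have s03 := hsymm 0 3
      have s04 := hsymm 0 4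
      have s05 := hsymm 0 5
      have s12 := hsymm 1 2
      have s13 := hsymm 1 3
      have s14 := hsymm 1 4
      have s15 := hsymm 1 5
      have s23 := hsymm 2 3
      have s24 := hsymm 2 4
      have s25 := hsymm 2 5
      have s34 := hsymm 3 4
      have s35 := hsymm 3 5
      have s45 := hsymm 4 5
      intro s t
      fin_cases s <;> fin_cases t <;> simp <;> linarith
    have hM : (Matrix.of w) * (Matrix.of w).transpose = 1 := by
      ext s t
      rw [Matrix.mul_apply, Matrix.one_apply, ← hG1, hG]
      rfl
    have h1 := Matrix.rank_mul_le_left (Matrix.of w) (Matrix.of w).transpose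
    rw [hM, Matrix.rank_one] at h1
    have h2 := (Matrix.of w).rank_le_width
    simp at h1
    exact h1.trans h2
end

section
/- The 4×3 simple biquadratic form P(x,y) = x₁²y₁² + x₂²y₁² + x₃²y₁² + x₁²y₂² + x₄²y₂² + x₂²y₃² + x₄²y₃² has sos rank exactly 7: it is a sum of 7 squares of 4×3 bilinear forms, and it cannot be written as a sum of fewer than 7 squares of bilinear forms. -/
/-- The edge weights of the simple biquadratic form. -/
def sosW : Fin 4 → Fin 3 → ℝ :=
  ![![1, 1, 0], ![1, 0, 1], ![1, 0, 0], ![0, 1, 1]]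

/-- The row index of the `n`-th edge. -/
def sosRow : Fin 7 → Fin 4 := ![0, 1, 2, 0, 3, 1, 3]

/-- The column index of the `n`-th edge. -/
def sosCol : Fin 7 → Fin 3 := ![0, 0, 0, 1, 1, 2, 2]

/-- Evaluation of a bilinear form on sums of unit vectors. -/
lemma sos_eval (d : Fin 4 → Fin 3 → ℝ) (i k : Fin 4) (j l : Fin 3) (s t : ℝ) :
    ∑ a, ∑ b, d a b * ((Pi.single i 1 : Fin 4 → ℝ) a + s * (Pi.single k 1 : Fin 4 → ℝ) a)
      * ((Pi.single j 1 : Fin 3 → ℝ) b + t * (Pi.single l 1 : Fin 3 → ℝ) b)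
    = d i j + t * d i l + s * d k j + s * t * d k l := by
  simp [mul_add, add_mul, Finset.sum_add_distrib, Pi.single_apply]
  ring

/-- The polarized identity between the coefficient vectors. -/
lemma sos_key {r : ℕ} (c : Fin r → Fin 4 → Fin 3 → ℝ)
    (h : ∀ (x : Fin 4 → ℝ) (y : Fin 3 → ℝ),
      ∑ i, ∑ j, sosW i j * x i ^ 2 * y j ^ 2 = ∑ p, (∑ i, ∑ j, c p i j * x i * y j) ^ 2)
    (i k : Fin 4) (j l : Fin 3) :
    ∑ p, c p i j * c p k l + ∑ p, c p i l * c p k j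
      = if i = k ∧ j = l then 2 * sosW i j else 0 := by
  have H : ∀ s t : ℝ, _ := fun s t => h
    (fun a => (Pi.single i 1 : Fin 4 → ℝ) a + s * (Pi.single k 1 : Fin 4 → ℝ) a)
    (fun b => (Pi.single j 1 : Fin 3 → ℝ) b + t * (Pi.single l 1 : Fin 3 → ℝ) b)
  simp only [sos_eval] at H
  have R : 8 * (∑ p, c p i j * c p k l + ∑ p, c p i l * c p k j)
      = ∑ p, (c p i j + 1 * c p i l + 1 * c p k j + 1 * 1 * c p k l) ^ 2
      - ∑ p, (c p i j + 1 * c p i l + (-1) * c p k j + (-1) * 1 * c p k l) ^ 2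
      - ∑ p, (c p i j + (-1) * c p i l + 1 * c p k j + 1 * (-1) * c p k l) ^ 2
      + ∑ p, (c p i j + (-1) * c p i l + (-1) * c p k j + (-1) * (-1) * c p k l) ^ 2 := by
    rw [← Finset.sum_add_distrib, Finset.mul_sum, ← Finset.sum_sub_distrib,
      ← Finset.sum_sub_distrib, ← Finset.sum_add_distrib]
    refine Finset.sum_congr rfl fun p _ => ?_
    ring
  rw [← H, ← H, ← H, ← H] at R
  have L : (16 : ℝ) * (if i = k ∧ j = l then sosW i j else 0)
      = ∑ a, ∑ b, 16 * sosW a b * ((Pi.single i 1 : Fin 4 → ℝ) a * (Pi.single k 1 : Fin 4 → ℝ) a)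
        * ((Pi.single j 1 : Fin 3 → ℝ) b * (Pi.single l 1 : Fin 3 → ℝ) b) := by
    by_cases h1 : i = k <;> by_cases h2 : j = l <;> simp [Pi.single_apply, h1, h2, eq_comm] <;> grind
  have M : 8 * (∑ p, c p i j * c p k l + ∑ p, c p i l * c p k j)
      = (16 : ℝ) * (if i = k ∧ j = l then sosW i j else 0) := by
    rw [R, L]
    simp only [← Finset.sum_add_distrib, ← Finset.sum_sub_distrib]
    refine Finset.sum_congr rfl fun a _ => Finset.sum_congr rfl fun b _ => ?_
    ring
  split_ifs at M ⊢ <;> linarith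

/-- The 4×3 simple biquadratic form
`P(x,y) = x₁²y₁² + x₂²y₁² + x₃²y₁² + x₁²y₂² + x₄²y₂² + x₂²y₃² + x₄²y₃²`
has sos rank exactly 7. -/
theorem sos_rank_four_by_three_example :
    IsLeast {r : ℕ | ∃ c : Fin r → Fin 4 → Fin 3 → ℝ,
        ∀ (x : Fin 4 → ℝ) (y : Fin 3 → ℝ),
          (x 0) ^ 2 * (y 0) ^ 2 + (x 1) ^ 2 * (y 0) ^ 2 + (x 2) ^ 2 * (y 0) ^ 2
            + (x 0) ^ 2 * (y 1) ^ 2 + (x 3) ^ 2 * (y 1) ^ 2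
            + (x 1) ^ 2 * (y 2) ^ 2 + (x 3) ^ 2 * (y 2) ^ 2
          = ∑ p, (∑ i, ∑ j, c p i j * x i * y j) ^ 2}
      7 := by
  constructor
  · refine ⟨fun p i j => if i = sosRow p ∧ j = sosCol p then 1 else 0, fun x y => ?_⟩
    have : ∀ p : Fin 7, (∑ i, ∑ j, (if i = sosRow p ∧ j = sosCol p then (1 : ℝ) else 0)
        * x i * y j) = x (sosRow p) * y (sosCol p) := by
      intro p
      simp [ite_and]
    simp only [this]
    simp [Fin.sum_univ_succ, sosRow, sosCol]
    ring
  · rintro r ⟨c, h⟩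
    have h' : ∀ (x : Fin 4 → ℝ) (y : Fin 3 → ℝ),
        ∑ i, ∑ j, sosW i j * x i ^ 2 * y j ^ 2
          = ∑ p, (∑ i, ∑ j, c p i j * x i * y j) ^ 2 := by
      intro x y
      rw [← h]
      simp [Fin.sum_univ_four, Fin.sum_univ_three, sosW]
      ring
    have key := sos_key c h'
    have norm : ∀ i j, ∑ p, c p i j * c p i j = sosW i j := by
      intro i j
      have := key i i j j
      simp at this
      linarith
    have zero : ∀ i j, sosW i j = 0 → ∀ p, c p i j = 0 := by
      intro i j hw p
      have h1 := norm i j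
      rw [hw, Finset.sum_eq_zero_iff_of_nonneg (fun p _ => mul_self_nonneg _)] at h1
      simpa using h1 p (Finset.mem_univ _)
    have orth : ∀ i j k l, ¬ (i = k ∧ j = l) →
        (i = k ∨ j = l ∨ sosW i l = 0 ∨ sosW k j = 0) → ∑ p, c p i j * c p k l = 0 := by
      intro i j k l hne hc
      have h1 := key i k j l
      rw [if_neg hne] at h1
      rcases hc with rfl | rfl | hc | hc
      · have : ∑ p, c p i l * c p i j = ∑ p, c p i j * c p i l :=
          Finset.sum_congr rfl fun p _ => mul_comm _ _
        linarith
      · linarith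
      · simpa [zero _ _ hc] using h1
      · simpa [zero _ _ hc] using h1
    let v : Fin 7 → EuclideanSpace ℝ (Fin r) :=
      fun e => WithLp.toLp 2 fun p => c p (sosRow e) (sosCol e)
    have hv : Orthonormal ℝ v := by
      rw [orthonormal_iff_ite]
      intro e f
      have hin : inner ℝ (v e) (v f)
          = ∑ p, c p (sosRow e) (sosCol e) * c p (sosRow f) (sosCol f) := by
        simp [v, PiLp.inner_apply, mul_comm]
      rw [hin]
      split_ifs with hef
      · subst hef
        rw [norm]
        fin_cases e <;> simp [sosW, sosRow, sosCol]
      · apply orth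
        · have inj : ∀ e f : Fin 7, ¬ e = f →
              ¬ (sosRow e = sosRow f ∧ sosCol e = sosCol f) := by decide
          exact inj e f hef
        · fin_cases e <;> fin_cases f <;> simp [sosW, sosRow, sosCol] at hef ⊢
    simpa using hv.linearIndependent.fintype_card_le_finrank
end

section
/- Let m, n ≥ 2. The set of real symmetric (mn)×(mn) matrices H, indexed by pairs (i,j) ∈ [m]×[n], satisfying zᵀ H z = 0 for all z ∈ ℝ^{mn} of the form z_{(i,j)} = x_i y_j with x ∈ ℝ^m, y ∈ ℝ^n, is a linear subspace of dimension (m choose 2)·(n choose 2). -/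
open Matrix

lemma card_lt_pairs (m : ℕ) :
    Fintype.card {p : Fin m × Fin m // p.1 < p.2} = m.choose 2 := by
  rw [Fintype.card_subtype, Finset.card_filter, Fintype.sum_prod_type_right]
  have h : ∀ k : Fin m, (∑ i : Fin m, if i < k then 1 else 0) = (k : ℕ) := by
    intro k
    rw [← Finset.card_filter, ← Fin.card_Iio k]
    congr 1
    ext i
    simp
  simp only [h]
  rw [Fin.sum_univ_eq_sum_range (fun i => i) m, Finset.sum_range_id, Nat.choose_two_right]

/-- The form `(x ⊗ y)ᵀ H (x' ⊗ y')`. -/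
noncomputable def tform {m n : ℕ} (H : Matrix (Fin m × Fin n) (Fin m × Fin n) ℝ)
    (x x' : Fin m → ℝ) (y y' : Fin n → ℝ) : ℝ :=
  (fun q : Fin m × Fin n => x q.1 * y q.2) ⬝ᵥ
            (H *ᵥ (fun q : Fin m × Fin n => x' q.1 * y' q.2))

section
variable {m n : ℕ} (H : Matrix (Fin m × Fin n) (Fin m × Fin n) ℝ)

lemma tform_eq (x x' : Fin m → ℝ) (y y' : Fin n → ℝ) :
    tform H x x' y y' = ∑ p : Fin m × Fin n, ∑ q : Fin m × Fin n,
      x p.1 * y p.2 * H p q * (x' q.1 * y' q.2) := by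
  simp only [tform, dotProduct, mulVec, Finset.mul_sum, mul_assoc]

lemma tform_add1 (x1 x2 x' : Fin m → ℝ) (y y' : Fin n → ℝ) :
    tform H (x1 + x2) x' y y' = tform H x1 x' y y' + tform H x2 x' y y' := by
  simp only [tform_eq, ← Finset.sum_add_distrib, Pi.add_apply, add_mul, mul_add]

lemma tform_add2 (x x1 x2 : Fin m → ℝ) (y y' : Fin n → ℝ) :
    tform H x (x1 + x2) y y' = tform H x x1 y y' + tform H x x2 y y' := by
  simp only [tform_eq, ← Finset.sum_add_distrib, Pi.add_apply, add_mul, mul_add]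

lemma tform_add3 (x x' : Fin m → ℝ) (y1 y2 y' : Fin n → ℝ) :
    tform H x x' (y1 + y2) y' = tform H x x' y1 y' + tform H x x' y2 y' := by
  simp only [tform_eq, ← Finset.sum_add_distrib, Pi.add_apply, add_mul, mul_add]

lemma tform_add4 (x x' : Fin m → ℝ) (y y1 y2 : Fin n → ℝ) :
    tform H x x' y (y1 + y2) = tform H x x' y y1 + tform H x x' y y2 := by
  simp only [tform_eq, ← Finset.sum_add_distrib, Pi.add_apply, add_mul, mul_add]

lemma tform_single (i k : Fin m) (j l : Fin n) :
    tform H (Pi.single i 1) (Pi.single k 1) (Pi.single j 1) (Pi.single l 1) =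
      H (i, j) (k, l) := by
  simp [tform_eq, Fintype.sum_prod_type, Pi.single_apply]

lemma mem_iff : (H.IsSymm ∧ ∀ (x : Fin m → ℝ) (y : Fin n → ℝ), tform H x x y y = 0) ↔
    ∀ i k j l, H (k, j) (i, l) = - H (i, j) (k, l) ∧ H (i, l) (k, j) = - H (i, j) (k, l) := by
  constructor
  · rintro ⟨hs, h⟩ i k j l
    have key : H (i, j) (k, l) + H (k, j) (i, l) + H (i, l) (k, j) + H (k, l) (i, j) = 0 := by
      simp only [← tform_single H]
      generalize (Pi.single i 1 : Fin m → ℝ) = a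
      generalize (Pi.single k 1 : Fin m → ℝ) = b
      generalize (Pi.single j 1 : Fin n → ℝ) = c
      generalize (Pi.single l 1 : Fin n → ℝ) = d
      have h1 := h (a + b) (c + d)
      have h2 := h (a + b) c
      have h3 := h (a + b) d
      have h4 := h a (c + d)
      have h5 := h b (c + d)
      simp only [tform_add1, tform_add2, tform_add3, tform_add4] at h1 h2 h3 h4 h5
      linarith [h a c, h a d, h b c, h b d]
    have s1 := hs.apply (i, j) (k, l)
    have s2 := hs.apply (i, l) (k, j)
    constructor <;> linarith
  · intro h
    refine ⟨?_, ?_⟩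
    · ext ⟨i, j⟩ ⟨k, l⟩
      have h1 := (h i k j l).1
      have h2 := (h k i j l).2
      simp only [transpose_apply]
      linarith
    · intro x y
      have : tform H x x y y = - tform H x x y y := by
        conv_lhs => rw [tform_eq]
        rw [tform_eq, ← Finset.sum_neg_distrib]
        simp only [← Finset.sum_neg_distrib]
        simp only [← Fintype.sum_prod_type']
        refine Fintype.sum_equiv
          ⟨fun p => ((p.2.1, p.1.2), (p.1.1, p.2.2)), fun p => ((p.2.1, p.1.2), (p.1.1, p.2.2)),
            fun _ => rfl, fun _ => rfl⟩ _ _ ?_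
        rintro ⟨⟨i, j⟩, ⟨k, l⟩⟩
        simp only [Equiv.coe_fn_mk, (h i k j l).1]
        ring
      linarith

end

/-- Matrices antisymmetric in both pairs of indices. -/
def antiSub (m n : ℕ) : Submodule ℝ (Matrix (Fin m × Fin n) (Fin m × Fin n) ℝ) where
  carrier := {H | ∀ i k j l,
    H (k, j) (i, l) = - H (i, j) (k, l) ∧ H (i, l) (k, j) = - H (i, j) (k, l)}
  add_mem' := by
    intro A B hA hB i k j l
    have := hA i k j l
    have := hB i k j l
    simp only [Matrix.add_apply]
    constructor <;> linarith
  zero_mem' := by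
    intro i k j l
    simp
  smul_mem' := by
    intro c A hA i k j l
    simp [(hA i k j l).1, (hA i k j l).2]

/-- Restriction to strictly increasing index pairs. -/
def restr (m n : ℕ) : antiSub m n →ₗ[ℝ]
    ({p : Fin m × Fin m // p.1 < p.2} × {q : Fin n × Fin n // q.1 < q.2} → ℝ) where
  toFun H := fun r => H.1 (r.1.1.1, r.2.1.1) (r.1.1.2, r.2.1.2)
  map_add' _ _ := rfl
  map_smul' _ _ := rfl

lemma restr_inj (m n : ℕ) : Function.Injective (restr m n) := by
  rw [injective_iff_map_eq_zero]
  rintro ⟨H, hH⟩ h0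
  have h0' : ∀ i k j l, i < k → j < l → H (i, j) (k, l) = 0 :=
    fun i k j l hik hjl => congrFun h0 (⟨(i, k), hik⟩, ⟨(j, l), hjl⟩)
  have h1 : ∀ i k j l, i < k → H (i, j) (k, l) = 0 := by
    intro i k j l hik
    have a := (hH i k j l).2
    rcases lt_trichotomy j l with hjl | rfl | hjl
    · exact h0' _ _ _ _ hik hjl
    · linarith
    · have := h0' i k l j hik hjl
      linarith
  ext ⟨i, j⟩ ⟨k, l⟩
  change H (i, j) (k, l) = 0
  have a := (hH i k j l).1
  rcases lt_trichotomy i k with hik | rfl | hik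
  · exact h1 _ _ _ _ hik
  · linarith
  · have := h1 k i j l hik
    linarith

lemma restr_surj (m n : ℕ) : Function.Surjective (restr m n) := by
  intro c
  let f : Fin m → Fin m → Fin n → Fin n → ℝ := fun i k j l =>
    if h : i < k ∧ j < l then c (⟨(i, k), h.1⟩, ⟨(j, l), h.2⟩) else 0
  refine ⟨⟨fun p q => f p.1 q.1 p.2 q.2 - f q.1 p.1 p.2 q.2 - f p.1 q.1 q.2 p.2
    + f q.1 p.1 q.2 p.2, ?_⟩, ?_⟩
  · intro i k j l
    constructor <;> ring
  · ext ⟨⟨⟨i, k⟩, hik⟩, ⟨⟨j, l⟩, hjl⟩⟩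
    change f i k j l - f k i j l - f i k l j + f k i l j = _
    have hik' : i < k := hik
    have hjl' : j < l := hjl
    simp [f, hik', hjl', hik'.not_gt, hjl'.not_gt]

/-- The set of real symmetric `(mn)×(mn)` matrices `H` (indexed by
pairs `(i,j) ∈ [m]×[n]`) with `zᵀ H z = 0` for all `z` of the form
`z_{(i,j)} = x_i y_j` is a linear subspace of dimension `(m choose 2)·(n choose 2)`. -/
theorem nullity_subspace_dimension (m n : ℕ) (hm : 2 ≤ m) (hn : 2 ≤ n) :
    ∃ S : Submodule ℝ (Matrix (Fin m × Fin n) (Fin m × Fin n) ℝ),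
      (↑S = {H : Matrix (Fin m × Fin n) (Fin m × Fin n) ℝ | H.IsSymm ∧
        ∀ (x : Fin m → ℝ) (y : Fin n → ℝ),
          (fun q : Fin m × Fin n => x q.1 * y q.2) ⬝ᵥ
            (H *ᵥ (fun q : Fin m × Fin n => x q.1 * y q.2)) = 0}) ∧
      Module.finrank ℝ S = m.choose 2 * n.choose 2 := by
  refine ⟨antiSub m n, ?_, ?_⟩
  · ext H
    exact (mem_iff H).symm
  · rw [(LinearEquiv.ofBijective (restr m n) ⟨restr_inj m n, restr_surj m n⟩).finrank_eq,
      Module.finrank_fintype_fun_eq_card, Fintype.card_prod, card_lt_pairs, card_lt_pairs]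
end
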